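/- Let (X,d) be a complete, simply-connected metric space equipped with a convex local geodesic bicombing σ. Then X is contractible. -/

import Mathlib

open Set Metric

/-- `c : [0,1] → X` is a geodesic: `d(c s, c t) = |s - t| ⬝ d(c 0, c 1)` for `s, t ∈ [0,1]`. -/
def IsGeodesicSegment {X : Type*} [MetricSpace X] (c : ℝ → X) : Prop :=
  ∀ s ∈ Icc (0:ℝ) 1, ∀ t ∈ Icc (0:ℝ) 1,
    dist (c s) (c t) = |s - t| * dist (c 0) (c 1)

/-- A local geodesic bicombing on a metric space `X`: an assignment `x ↦ r x > 0` and a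
selection `σ y z` of geodesics from `y` to `z` for pairs `y, z` lying in a common ball
`U(x, r x)`, staying in that ball, and consistent with taking subsegments. -/
structure LocalGeodesicBicombing (X : Type*) [MetricSpace X] where
  r : X → ℝ
  r_pos : ∀ x, 0 < r x
  σ : X → X → ℝ → X
  source : ∀ x y z, y ∈ ball x (r x) → z ∈ ball x (r x) → σ y z 0 = y
  target : ∀ x y z, y ∈ ball x (r x) → z ∈ ball x (r x) → σ y z 1 = z
  geodesic : ∀ x y z, y ∈ ball x (r x) → z ∈ ball x (r x) →
    ∀ s ∈ Icc (0:ℝ) 1, ∀ t ∈ Icc (0:ℝ) 1, dist (σ y z s) (σ y z t) = |s - t| * dist y z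
  mem_ball : ∀ x y z, y ∈ ball x (r x) → z ∈ ball x (r x) →
    ∀ t ∈ Icc (0:ℝ) 1, σ y z t ∈ ball x (r x)
  consistent : ∀ x y z, y ∈ ball x (r x) → z ∈ ball x (r x) →
    ∀ a b, 0 ≤ a → a ≤ b → b ≤ 1 → ∀ t ∈ Icc (0:ℝ) 1,
      σ (σ y z a) (σ y z b) t = σ y z ((1 - t) * a + t * b)

namespace LocalGeodesicBicombing

variable {X : Type*} [MetricSpace X]

/-- The domain `U` of the local bicombing: pairs of points lying in a common ball `U(x, r x)`. -/
def InDom (L : LocalGeodesicBicombing X) (y z : X) : Prop :=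
  ∃ x, y ∈ ball x (L.r x) ∧ z ∈ ball x (L.r x)

/-- A local geodesic bicombing is convex if it is locally convex. -/
def IsConvex (L : LocalGeodesicBicombing X) : Prop :=
  ∀ x, ∀ y ∈ ball x (L.r x), ∀ z ∈ ball x (L.r x), ∀ y' ∈ ball x (L.r x), ∀ z' ∈ ball x (L.r x),
    ConvexOn ℝ (Icc (0:ℝ) 1) (fun t => dist (L.σ y z t) (L.σ y' z' t))

/-- A local geodesic bicombing is reversible if `σ z y (t) = σ y z (1 - t)` on its domain. -/
def IsReversible (L : LocalGeodesicBicombing X) : Prop :=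
  ∀ y z, L.InDom y z → ∀ t ∈ Icc (0:ℝ) 1, L.σ z y t = L.σ y z (1 - t)

end LocalGeodesicBicombing

/-- The length `L(γ)` of a curve `γ : [0,1] → X` (as a real number; the supremum over
partitions of `[0,1]` of the sums of consecutive distances). -/
noncomputable def curveLength {X : Type*} [MetricSpace X] (γ : ℝ → X) : ℝ :=
  (eVariationOn γ (Icc (0:ℝ) 1)).toReal

/-- `c : [0,1] → X` is a local geodesic: every `t ∈ [0,1]` has a neighborhood in `[0,1]` on
which `d(c s, c s') = |s - s'| ⬝ L(c)`. -/
def IsLocalGeodesic {X : Type*} [MetricSpace X] (c : ℝ → X) : Prop :=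
  ∀ t ∈ Icc (0:ℝ) 1, ∃ ε > (0:ℝ),
    ∀ s ∈ Icc (0:ℝ) 1 ∩ Ioo (t - ε) (t + ε), ∀ s' ∈ Icc (0:ℝ) 1 ∩ Ioo (t - ε) (t + ε),
      dist (c s) (c s') = |s - s'| * curveLength c

/-- A curve `c : [0,1] → X` is consistent with the local geodesic bicombing `L` if
`c ((1-t)a + tb) = σ (c a) (c b) t` whenever `0 ≤ a ≤ b ≤ 1` and `(c a, c b)` is in the
domain of `L`. -/
def LocalGeodesicBicombing.ConsistentWith {X : Type*} [MetricSpace X]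
    (L : LocalGeodesicBicombing X) (c : ℝ → X) : Prop :=
  ∀ a b, 0 ≤ a → a ≤ b → b ≤ 1 → L.InDom (c a) (c b) →
    ∀ t ∈ Icc (0:ℝ) 1, c ((1 - t) * a + t * b) = L.σ (c a) (c b) t

/-- The induced length metric `d̄(x,y)`: the infimum of lengths of continuous curves from
`x` to `y`. -/
noncomputable def lengthMetric {X : Type*} [MetricSpace X] (x y : X) : ℝ :=
  (⨅ (γ : ℝ → X) (_ : ContinuousOn γ (Icc (0:ℝ) 1)) (_ : γ 0 = x) (_ : γ 1 = y),
    eVariationOn γ (Icc (0:ℝ) 1)).toReal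

/-- `σ'` is a convex geodesic bicombing on `(X, d̄)` (where `d̄` is the induced length metric)
which is consistent with the local geodesic bicombing `L` on `(X, d)`: each `σ' x y` is a
geodesic from `x` to `y` with respect to `d̄`, the selection is consistent with taking
subsegments, the function `t ↦ d̄(σ' x y t, σ' x' y' t)` is convex on `[0,1]`, and each
`σ' x y`, viewed as a map into `(X, d)`, is a local geodesic consistent with `L`. -/
structure IsConsistentConvexBicombing {X : Type*} [MetricSpace X]
    (L : LocalGeodesicBicombing X) (σ' : X → X → ℝ → X) : Prop where
  source : ∀ x y, σ' x y 0 = x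
  target : ∀ x y, σ' x y 1 = y
  geodesic : ∀ x y, ∀ s ∈ Icc (0:ℝ) 1, ∀ t ∈ Icc (0:ℝ) 1,
    lengthMetric (σ' x y s) (σ' x y t) = |s - t| * lengthMetric x y
  consistent : ∀ x y a b, 0 ≤ a → a ≤ b → b ≤ 1 → ∀ t ∈ Icc (0:ℝ) 1,
    σ' (σ' x y a) (σ' x y b) t = σ' x y ((1 - t) * a + t * b)
  convex : ∀ x y x' y', ConvexOn ℝ (Icc (0:ℝ) 1)
    (fun t => lengthMetric (σ' x y t) (σ' x' y' t))
  localGeodesic : ∀ x y, IsLocalGeodesic (σ' x y)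
  consistentWith : ∀ x y, L.ConsistentWith (σ' x y)

open Topology unitInterval

section Covering

/-- If a separated local homeomorphism has a continuous section through each point lying over
some preconnected open set `U`, then every point of `U` is evenly covered. -/
theorem IsLocalHomeomorph.isEvenlyCovered_of_sections {E X : Type*} [TopologicalSpace E]
    [TopologicalSpace X] {p : E → X} (hp : IsLocalHomeomorph p) (sep : IsSeparatedMap p)
    {U : Set X} (hU : IsOpen U) (hU' : IsPreconnected U) {x : X} (hx : x ∈ U)
    (hs : ∀ e (he : p e ∈ U), ∃ s : U → E, Continuous s ∧ (∀ y, p (s y) = y) ∧ s ⟨p e, he⟩ = e) :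
    IsEvenlyCovered p x (p ⁻¹' {x}) := by
  have : PreconnectedSpace U := isPreconnected_iff_preconnectedSpace.mp hU'
  have hU'' : ∀ e : p ⁻¹' {x}, p e ∈ U := fun e => by
    have : p e = x := e.2
    rwa [this]
  choose s s_cont s_sec s_base using hs
  have key : ∀ e he e' he' y, s e he y = s e' he' y → s e he = s e' he' := fun e he e' he' y h =>
    sep.eq_of_comp_eq hp.isLocallyInjective (s_cont e he) (s_cont e' he')
      (by ext z; simp [s_sec]) y h
  have key' : ∀ e he y hy, s (s e he y) hy = s e he := fun e he y hy =>
    key _ _ _ _ y (by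
      have := s_base (s e he y) hy
      simpa [s_sec] using this)
  have disc : DiscreteTopology (p ⁻¹' {x}) := by
    rw [discreteTopology_iff_singleton_mem_nhds]
    intro e
    obtain ⟨V, hV, inj⟩ := isLocallyInjective_iff_nhds.mp hp.isLocallyInjective (e : E)
    filter_upwards [continuous_subtype_val.continuousAt hV] with e' he'
    refine Subtype.ext (inj he' (mem_of_mem_nhds hV) ?_)
    exact e'.2.trans e.2.symm
  refine ⟨disc, U, hx, hU, hU.preimage hp.continuous,
    { toFun := fun e => (⟨p e, e.2⟩, ⟨s e e.2 ⟨x, hx⟩, s_sec _ _ _⟩)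
      invFun := fun a => ⟨s a.2 (hU'' a.2) a.1, by
        rw [mem_preimage, s_sec]; exact a.1.2⟩
      left_inv := ?_
      right_inv := ?_
      continuous_toFun := ?_
      continuous_invFun := ?_ }, fun e => rfl⟩
  · intro e
    refine Subtype.ext ?_
    simp only [key']
    exact s_base e e.2
  · rintro ⟨y, e⟩
    refine Prod.ext (Subtype.ext ?_) (Subtype.ext ?_)
    · simp [s_sec]
    · simp only [key']
      have := s_base e (hU'' e)
      have h' : p e = x := e.2
      simpa [h'] using this
  · refine Continuous.prodMk ((hp.continuous.comp continuous_subtype_val).subtype_mk _) ?_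
    rw [continuous_iff_continuousAt]
    intro e
    refine ContinuousAt.congr (continuousAt_const (y := ⟨s e e.2 ⟨x, hx⟩, s_sec _ _ _⟩)) ?_
    obtain ⟨V, hV, inj⟩ := isLocallyInjective_iff_nhds.mp hp.isLocallyInjective (e : E)
    have c1 : Continuous fun e' : p ⁻¹' U => s e e.2 ⟨p e', e'.2⟩ :=
      (s_cont e e.2).comp ((hp.continuous.comp continuous_subtype_val).subtype_mk _)
    have h1 : ∀ᶠ e' : p ⁻¹' U in 𝓝 e, s e e.2 ⟨p e', e'.2⟩ ∈ V :=
      c1.continuousAt (by rw [s_base e e.2]; exact hV)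
    have h2 : ∀ᶠ e' : p ⁻¹' U in 𝓝 e, (e' : E) ∈ V := continuous_subtype_val.continuousAt hV
    filter_upwards [h1, h2] with e' h1 h2
    have h3 : s e e.2 ⟨p e', e'.2⟩ = s e' e'.2 ⟨p e', e'.2⟩ := by
      rw [s_base e' e'.2]
      exact inj h1 h2 (s_sec _ _ _)
    exact Subtype.ext (congrFun (key _ _ _ _ _ h3) _)
  · refine Continuous.subtype_mk ?_ _
    rw [continuous_prod_of_discrete_right]
    exact fun e => s_cont e (hU'' e)

variable {E X : Type*} [MetricSpace E] [MetricSpace X] {p : E → X}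

/-- A map between metric spaces is a local isometry if it restricts to an isometry from a ball
around any point onto the ball of the same radius around the image of that point. -/
def IsLocalIsometry (p : E → X) : Prop :=
  ∀ e, ∃ ε > 0, (∀ e' ∈ ball e ε, ∀ e'' ∈ ball e ε, dist (p e') (p e'') = dist e' e'') ∧
    ∀ y ∈ ball (p e) ε, ∃ e' ∈ ball e ε, p e' = y

theorem IsLocalIsometry.isLocalHomeomorph (hp : IsLocalIsometry p) : IsLocalHomeomorph p := by
  rw [isLocalHomeomorph_iff_isOpenEmbedding_restrict]
  intro e
  obtain ⟨ε, hε, iso, surj⟩ := hp e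
  refine ⟨ball e ε, ball_mem_nhds e hε, ?_⟩
  have hi : Isometry ((ball e ε).domRestrict p) :=
    Isometry.of_dist_eq fun a b => iso a a.2 b b.2
  refine ⟨hi.isEmbedding, ?_⟩
  convert isOpen_ball (x := p e) (ε := ε)
  ext y
  constructor
  · rintro ⟨⟨e', he'⟩, rfl⟩
    have := iso e' he' e (mem_ball_self hε)
    simpa [mem_ball, domRestrict, this] using he'
  · intro hy
    obtain ⟨a, ha, rfl⟩ := surj y hy
    exact ⟨⟨a, ha⟩, rfl⟩

/-- `g` is a `K`-Lipschitz lift of `γ` on `[0, s]` starting at `e`. -/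
structure IsLipschitzLift (p : E → X) (γ : ℝ → X) (K : ℝ) (e : E) (s : ℝ) (g : ℝ → E) : Prop where
  zero : g 0 = e
  lifts : ∀ t ∈ Icc 0 s, p (g t) = γ t
  lipschitz : ∀ a ∈ Icc 0 s, ∀ b ∈ Icc 0 s, dist (g a) (g b) ≤ K * |a - b|

theorem continuousOn_of_dist_le_mul_abs {g : ℝ → E} {S : Set ℝ} {K : ℝ}
    (h : ∀ a ∈ S, ∀ b ∈ S, dist (g a) (g b) ≤ K * |a - b|) : ContinuousOn g S := by
  refine LipschitzOnWith.continuousOn (K := K.toNNReal) (LipschitzOnWith.of_dist_le_mul ?_)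
  intro a ha b hb
  refine (h a ha b hb).trans ?_
  rw [Real.dist_eq]
  gcongr
  exact Real.le_coe_toNNReal K

namespace IsLipschitzLift

variable {γ : ℝ → X} {K : ℝ} {e : E} {s s' : ℝ} {g g' : ℝ → E}

theorem mono (h : IsLipschitzLift p γ K e s g) (hs : s' ≤ s) : IsLipschitzLift p γ K e s' g :=
  ⟨h.zero, fun t ht => h.lifts t ⟨ht.1, ht.2.trans hs⟩, fun a ha b hb =>
    h.lipschitz a ⟨ha.1, ha.2.trans hs⟩ b ⟨hb.1, hb.2.trans hs⟩⟩

theorem eqOn (hp : IsLocalIsometry p) (h : IsLipschitzLift p γ K e s g)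
    (h' : IsLipschitzLift p γ K e s g') : EqOn g g' (Icc 0 s) := by
  intro t ht
  refine (T2Space.isSeparatedMap p).eqOn_of_comp_eqOn hp.isLocalHomeomorph.isLocallyInjective
    isPreconnected_Icc (continuousOn_of_dist_le_mul_abs h.lipschitz)
    (continuousOn_of_dist_le_mul_abs h'.lipschitz) (fun t ht => ?_)
    (left_mem_Icc.mpr (ht.1.trans ht.2)) (h.zero.trans h'.zero.symm) ht
  simp [h.lifts t ht, h'.lifts t ht]

theorem exists_extension (hp : IsLocalIsometry p) (hK : 0 ≤ K)
    (hγ : ∀ a b, dist (γ a) (γ b) ≤ K * |a - b|) (hs : 0 ≤ s)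
    (h : IsLipschitzLift p γ K e s g) : ∃ δ > 0, ∃ g', IsLipschitzLift p γ K e (s + δ) g' := by
  classical
  obtain ⟨ε, hε, iso, surj⟩ := hp (g s)
  have hgs : p (g s) = γ s := h.lifts s ⟨hs, le_rfl⟩
  refine ⟨ε / (K + 1), by positivity, ?_⟩
  have hball : ∀ t ∈ Icc s (s + ε / (K + 1)), γ t ∈ ball (p (g s)) ε := by
    intro t ht
    rw [hgs, mem_ball]
    calc dist (γ t) (γ s) ≤ K * |t - s| := hγ t s
      _ ≤ K * (ε / (K + 1)) := by
        gcongr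
        rw [abs_of_nonneg (by linarith [ht.1])]
        linarith [ht.2]
      _ < ε := by
        rw [mul_div_assoc', div_lt_iff₀ (by positivity)]
        nlinarith
  have : Nonempty E := ⟨e⟩
  choose! l hl hpl using surj
  have hl' : ∀ a ∈ Icc s (s + ε / (K + 1)), ∀ b ∈ Icc s (s + ε / (K + 1)),
      dist (l (γ a)) (l (γ b)) ≤ K * |a - b| := by
    intro a ha b hb
    rw [← iso _ (hl _ (hball a ha)) _ (hl _ (hball b hb)), hpl _ (hball a ha), hpl _ (hball b hb)]
    exact hγ a b
  have hss : s ∈ Icc s (s + ε / (K + 1)) := ⟨le_rfl, le_add_of_nonneg_right (by positivity)⟩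
  have hls : l (γ s) = g s := by
    rw [← dist_eq_zero, ← iso _ (hl _ (hball s hss)) _ (mem_ball_self hε), hpl _ (hball s hss), hgs,
      dist_self]
  have hab : ∀ a b, 0 ≤ a → a ≤ s → s ≤ b → b ≤ s + ε / (K + 1) →
      dist (g a) (l (γ b)) ≤ K * |a - b| := by
    intro a b h0 h1 h2 h3
    calc dist (g a) (l (γ b)) ≤ dist (g a) (g s) + dist (l (γ s)) (l (γ b)) := by
          rw [hls]; exact dist_triangle _ _ _
      _ ≤ K * |a - s| + K * |s - b| :=
        add_le_add (h.lipschitz a ⟨h0, h1⟩ s ⟨hs, le_rfl⟩) (hl' s hss b ⟨h2, h3⟩)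
      _ = K * |a - b| := by
        rw [abs_of_nonpos (by linarith), abs_of_nonpos (by linarith), abs_of_nonpos (by linarith)]
        ring
  refine ⟨fun t => if t ≤ s then g t else l (γ t), by simp [hs, h.zero], fun t ht => ?_,
    fun a ha b hb => ?_⟩
  · split_ifs with hts
    · exact h.lifts t ⟨ht.1, hts⟩
    · exact hpl _ (hball t ⟨(not_le.mp hts).le, ht.2⟩)
  · split_ifs with h1 h2 h2
    · exact h.lipschitz a ⟨ha.1, h1⟩ b ⟨hb.1, h2⟩
    · exact hab a b ha.1 h1 (not_le.mp h2).le hb.2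
    · rw [dist_comm, abs_sub_comm]
      exact hab b a hb.1 h2 (not_le.mp h1).le ha.2
    · exact hl' a ⟨(not_le.mp h1).le, ha.2⟩ b ⟨(not_le.mp h2).le, hb.2⟩

theorem exists_of_tendsto [CompleteSpace E] (hp : IsLocalIsometry p) (hγ : Continuous γ)
    {u : ℕ → ℝ} (hu0 : ∀ n, 0 ≤ u n) (hus : ∀ n, u n < s)
    (hu : Filter.Tendsto u Filter.atTop (𝓝 s))
    (h : ∀ n, ∃ g, IsLipschitzLift p γ K e (u n) g) : ∃ g, IsLipschitzLift p γ K e s g := by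
  classical
  have h0s : 0 < s := (hu0 0).trans_lt (hus 0)
  have h' : ∀ t, t < s → ∃ g, IsLipschitzLift p γ K e t g := fun t ht => by
    obtain ⟨n, hn⟩ := (hu.eventually (lt_mem_nhds ht)).exists
    obtain ⟨g, hg⟩ := h n
    exact ⟨g, hg.mono hn.le⟩
  have : Nonempty E := ⟨e⟩
  choose! l hl using h'
  have hG : ∀ t < s, ∀ a ∈ Icc 0 t, l a a = l t a := fun t ht a ha =>
    (hl a (ha.2.trans_lt ht)).eqOn hp ((hl t ht).mono ha.2) ⟨ha.1, le_rfl⟩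
  have lip : ∀ a ∈ Ico 0 s, ∀ b ∈ Ico 0 s, dist (l a a) (l b b) ≤ K * |a - b| := by
    intro a ha b hb
    have hm : max a b < s := max_lt ha.2 hb.2
    rw [hG _ hm a ⟨ha.1, le_max_left _ _⟩, hG _ hm b ⟨hb.1, le_max_right _ _⟩]
    exact (hl _ hm).lipschitz a ⟨ha.1, le_max_left _ _⟩ b ⟨hb.1, le_max_right _ _⟩
  have hcau : CauchySeq fun n => l (u n) (u n) := by
    have hc := hu.cauchySeq
    rw [Metric.cauchySeq_iff] at hc ⊢
    intro ε hε
    obtain ⟨N, hN⟩ := hc (ε / (|K| + 1)) (by positivity)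
    refine ⟨N, fun m hm n hn => ?_⟩
    have h1 := hN m hm n hn
    rw [Real.dist_eq, lt_div_iff₀ (by positivity)] at h1
    have h2 := lip (u m) ⟨hu0 m, hus m⟩ (u n) ⟨hu0 n, hus n⟩
    nlinarith [abs_nonneg (u m - u n), le_abs_self K]
  obtain ⟨e', he'⟩ := cauchySeq_tendsto_of_complete hcau
  have lim : ∀ a ∈ Ico 0 s, dist (l a a) e' ≤ K * |a - s| := by
    intro a ha
    refine le_of_tendsto_of_tendsto' (tendsto_const_nhds.dist he')
      ((tendsto_const_nhds.sub hu).abs.const_mul K) fun n => ?_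
    exact lip a ha (u n) ⟨hu0 n, hus n⟩
  have hpe : p e' = γ s := by
    refine tendsto_nhds_unique ((hp.isLocalHomeomorph.continuous.tendsto e').comp he') ?_
    refine ((hγ.tendsto s).comp hu).congr fun n => ?_
    exact ((hl (u n) (hus n)).lifts (u n) ⟨hu0 n, le_rfl⟩).symm
  refine ⟨fun t => if t < s then l t t else e', by simpa [h0s] using (hl 0 h0s).zero,
    fun t ht => ?_, fun a ha b hb => ?_⟩
  · split_ifs with hts
    · exact (hl t hts).lifts t ⟨ht.1, le_rfl⟩
    · rw [hpe, le_antisymm ht.2 (not_lt.mp hts)]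
  · split_ifs with h1 h2 h2
    · exact lip a ⟨ha.1, h1⟩ b ⟨hb.1, h2⟩
    · rw [le_antisymm hb.2 (not_lt.mp h2)]
      exact lim a ⟨ha.1, h1⟩
    · rw [le_antisymm ha.2 (not_lt.mp h1), dist_comm, abs_sub_comm]
      exact lim b ⟨hb.1, h2⟩
    · simp [le_antisymm ha.2 (not_lt.mp h1), le_antisymm hb.2 (not_lt.mp h2)]

end IsLipschitzLift

/-- Lipschitz paths lift through a local isometry whose domain is complete. -/
theorem IsLocalIsometry.exists_isLipschitzLift [CompleteSpace E] (hp : IsLocalIsometry p)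
    {γ : ℝ → X} {K : ℝ} (hK : 0 ≤ K) (hγ : ∀ a b, dist (γ a) (γ b) ≤ K * |a - b|) {e : E}
    (he : p e = γ 0) : ∃ g, IsLipschitzLift p γ K e 1 g := by
  have hγc : Continuous γ := continuousOn_univ.mp
    (continuousOn_of_dist_le_mul_abs fun a _ b _ => hγ a b)
  let S : Set ℝ := {s | ∃ g, IsLipschitzLift p γ K e s g}
  change (1 : ℝ) ∈ S
  have h0 : (0 : ℝ) ∈ S := by
    refine ⟨fun _ => e, rfl, fun t ht => ?_, fun a _ b _ => ?_⟩
    · rw [he, le_antisymm ht.2 ht.1]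
    · rw [dist_self]; positivity
  refine IsClosed.mem_of_ge_of_forall_exists_gt (a := 0) ?_ h0 zero_le_one ?_
  · refine IsSeqClosed.isClosed fun u s hu hus => ?_
    have hs : s ∈ Icc (0 : ℝ) 1 := isClosed_Icc.mem_of_tendsto hus
      (Filter.Eventually.of_forall fun n => (hu n).2)
    refine ⟨?_, hs⟩
    by_cases h : ∃ n, s ≤ u n
    · obtain ⟨n, hn⟩ := h
      obtain ⟨g, hg⟩ := (hu n).1
      exact ⟨g, hg.mono hn⟩
    · push Not at h
      exact IsLipschitzLift.exists_of_tendsto hp hγc (fun n => (hu n).2.1) h hus fun n => (hu n).1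
  · rintro s ⟨⟨g, hg⟩, hs⟩
    obtain ⟨δ, hδ, g', hg'⟩ := hg.exists_extension hp hK hγ hs.1
    exact ⟨min 1 (s + δ), ⟨g', hg'.mono (min_le_right _ _)⟩, lt_min hs.2 (by linarith),
      min_le_left _ _⟩

/-- A continuous family of Lipschitz paths issuing from `p e` lifts to a continuous family of
endpoints. -/
theorem IsLocalIsometry.exists_lift_of_contraction [CompleteSpace E] (hp : IsLocalIsometry p)
    {A : Type*} [TopologicalSpace A] (f : C(I × A, X)) {K : A → ℝ} (hK : ∀ a, 0 ≤ K a)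
    (hf : ∀ a s t, dist (f (s, a)) (f (t, a)) ≤ K a * |(s : ℝ) - t|) {e : E}
    (he : ∀ a, f (0, a) = p e) :
    ∃ s : A → E, Continuous s ∧ (∀ a, p (s a) = f (1, a)) ∧ ∀ a, dist e (s a) ≤ K a := by
  have hγ : ∀ a, ∃ g,
      IsLipschitzLift p (fun t : ℝ => f (projIcc 0 1 zero_le_one t, a)) (K a) e 1 g := by
    refine fun a => hp.exists_isLipschitzLift (hK a) (fun s t => ?_) ?_
    · refine (hf a _ _).trans ?_
      exact mul_le_mul_of_nonneg_left (abs_projIcc_sub_projIcc (zero_le_one' ℝ)) (hK a)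
    · simp [he]
  choose g hg using hγ
  have hcont : Continuous fun x : I × A => g x.2 x.1 := by
    refine hp.isLocalHomeomorph.continuous_lift (T2Space.isSeparatedMap p) f ?_ ?_ fun a => ?_
    · ext ⟨t, a⟩
      simpa using (hg a).lifts t t.2
    · simpa [(hg _).zero] using continuous_const
    · exact (continuousOn_of_dist_le_mul_abs (hg a).lipschitz).comp_continuous
        continuous_subtype_val fun t => t.2
  refine ⟨fun a => g a 1, hcont.comp (Continuous.prodMk_right (1 : I)), fun a => ?_, fun a => ?_⟩
  · simpa using (hg a).lifts 1 ⟨zero_le_one, le_rfl⟩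
  · have := (hg a).lipschitz 0 ⟨le_rfl, zero_le_one⟩ 1 ⟨zero_le_one, le_rfl⟩
    simpa [(hg a).zero] using this

end Covering

/-- A continuous function on `[0, 1]` satisfying a midpoint inequality around every interior
point lies below its chord. -/
theorem le_chord_of_midpoint_le {f : ℝ → ℝ} (hf : ContinuousOn f (Icc 0 1))
    (h : ∀ t ∈ Ioo (0 : ℝ) 1, ∃ η > 0, 0 ≤ t - η ∧ t + η ≤ 1 ∧ 2 * f t ≤ f (t - η) + f (t + η))
    {t : ℝ} (ht : t ∈ Icc (0 : ℝ) 1) : f t ≤ (1 - t) * f 0 + t * f 1 := by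
  let g : ℝ → ℝ := fun t => f t - ((1 - t) * f 0 + t * f 1)
  have hg : ContinuousOn g (Icc 0 1) := hf.sub (by fun_prop)
  suffices g t ≤ 0 by simpa [g] using this
  obtain ⟨m, hm, hmax⟩ := isCompact_Icc.exists_isMaxOn ⟨t, ht⟩ hg
  have hS : IsCompact (Icc (0 : ℝ) 1 ∩ g ⁻¹' {g m}) :=
    isCompact_Icc.of_isClosed_subset (hg.preimage_isClosed_of_isClosed isClosed_Icc
      isClosed_singleton) inter_subset_left
  obtain ⟨τ, ⟨hτ, hτm⟩, hτmax⟩ := hS.exists_isGreatest ⟨m, hm, rfl⟩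
  have hτm : g τ = g m := hτm
  have hle : ∀ u ∈ Icc (0 : ℝ) 1, g u ≤ g τ := fun u hu => hτm ▸ hmax hu
  refine (hle t ht).trans ?_
  rcases hτ.1.eq_or_lt with h0 | h0
  · simp [← h0, g]
  rcases hτ.2.eq_or_lt with h1 | h1
  · simp [h1, g]
  exfalso
  obtain ⟨η, hη, ha, hb, hfη⟩ := h τ ⟨h0, h1⟩
  have hl := hle (τ - η) ⟨ha, by linarith⟩
  have hr : g (τ + η) < g τ := by
    refine lt_of_le_of_ne (hle _ ⟨by linarith, hb⟩) fun heq => ?_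
    have := hτmax ⟨⟨by linarith, hb⟩, heq.trans hτm⟩
    linarith
  simp only [g] at hl hr
  linarith

namespace LocalGeodesicBicombing

section Straight

variable {X : Type*} [MetricSpace X] {L : LocalGeodesicBicombing X}

theorem IsConvex.dist_le (hL : L.IsConvex) {x y z y' z' : X} (hy : y ∈ ball x (L.r x))
    (hz : z ∈ ball x (L.r x)) (hy' : y' ∈ ball x (L.r x)) (hz' : z' ∈ ball x (L.r x))
    {t : ℝ} (ht : t ∈ Icc (0 : ℝ) 1) :
    dist (L.σ y z t) (L.σ y' z' t) ≤ (1 - t) * dist y y' + t * dist z z' := by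
  have := (hL x y hy z hz y' hy' z' hz').2 (left_mem_Icc.mpr zero_le_one)
    (right_mem_Icc.mpr zero_le_one) (sub_nonneg.mpr ht.2) ht.1 (by ring)
  simpa [L.source x y z hy hz, L.source x y' z' hy' hz', L.target x y z hy hz,
    L.target x y' z' hy' hz'] using this

theorem IsConvex.two_mul_dist_le (hL : L.IsConvex) {x y z y' z' : X} (hy : y ∈ ball x (L.r x))
    (hz : z ∈ ball x (L.r x)) (hy' : y' ∈ ball x (L.r x)) (hz' : z' ∈ ball x (L.r x)) :
    2 * dist (L.σ y z (1 / 2)) (L.σ y' z' (1 / 2)) ≤ dist y y' + dist z z' := by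
  have := hL.dist_le hy hz hy' hz' (t := 1 / 2) (by norm_num)
  linarith

/-- The midpoint map of a convex local bicombing is continuous on the balls `U(x, r x)`. -/
theorem IsConvex.tendsto_midpoint (hL : L.IsConvex) {ι : Type*} {l : Filter ι} {x y z : X}
    (hy : y ∈ ball x (L.r x)) (hz : z ∈ ball x (L.r x)) {u v : ι → X}
    (hu : Filter.Tendsto u l (𝓝 y)) (hv : Filter.Tendsto v l (𝓝 z)) :
    Filter.Tendsto (fun n => L.σ (u n) (v n) (1 / 2)) l (𝓝 (L.σ y z (1 / 2))) := by
  rw [tendsto_iff_dist_tendsto_zero] at hu hv ⊢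
  refine squeeze_zero' (Filter.Eventually.of_forall fun _ => dist_nonneg) ?_
    (by simpa using (hu.add hv).div_const 2)
  have hu' := (tendsto_iff_dist_tendsto_zero.mpr hu).eventually_mem (isOpen_ball.mem_nhds hy)
  have hv' := (tendsto_iff_dist_tendsto_zero.mpr hv).eventually_mem (isOpen_ball.mem_nhds hz)
  filter_upwards [hu', hv'] with n h1 h2
  linarith [hL.two_mul_dist_le h1 h2 hy hz]

theorem continuousOn_σ (L : LocalGeodesicBicombing X) {x y z : X} (hy : y ∈ ball x (L.r x))
    (hz : z ∈ ball x (L.r x)) : ContinuousOn (L.σ y z) (Icc 0 1) :=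
  continuousOn_of_dist_le_mul_abs (K := dist y z) fun a ha b hb => by
    rw [L.geodesic x y z hy hz a ha b hb, mul_comm]

/-- A curve is straight if `c t` is the midpoint of `c (t - h)` and `c (t + h)` whenever `c` maps
`[t - h, t + h]` into one of the balls `U(x, r x)`. -/
def IsStraight (L : LocalGeodesicBicombing X) (c : ℝ → X) : Prop :=
  ∀ x t h, 0 ≤ h → 0 ≤ t - h → t + h ≤ 1 → (∀ u ∈ Icc (t - h) (t + h), c u ∈ ball x (L.r x)) →
    c t = L.σ (c (t - h)) (c (t + h)) (1 / 2)

theorem IsStraight.congr {c c' : ℝ → X} (hc : L.IsStraight c) (h : EqOn c c' (Icc 0 1)) :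
    L.IsStraight c' := by
  intro x t η h0 h1 h2 hu
  rw [← h ⟨by linarith, by linarith⟩, ← h ⟨by linarith, by linarith⟩,
    ← h ⟨by linarith, by linarith⟩]
  refine hc x t η h0 h1 h2 fun u hu' => ?_
  rw [h ⟨h1.trans hu'.1, hu'.2.trans h2⟩]
  exact hu u hu'

theorem isStraight_const (L : LocalGeodesicBicombing X) (y : X) : L.IsStraight fun _ => y := by
  intro x t h h0 _ _ hu
  have hy := hu t ⟨by linarith, by linarith⟩
  have h1 := L.geodesic x y y hy hy 0 (by norm_num) (1 / 2) (by norm_num)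
  rw [dist_self, mul_zero, dist_eq_zero, L.source x y y hy hy] at h1
  exact h1

theorem IsConvex.isStraight_of_locally (hL : L.IsConvex) {c : ℝ → X}
    (hc : ContinuousOn c (Icc 0 1))
    (hloc : ∀ t ∈ Ioo (0 : ℝ) 1, ∃ δ > 0, ∀ h, 0 < h → h < δ →
      c t = L.σ (c (t - h)) (c (t + h)) (1 / 2)) : L.IsStraight c := by
  intro x t h h0 h1 h2 hu
  have hl := hu (t - h) ⟨le_rfl, by linarith⟩
  have hr := hu (t + h) ⟨by linarith, le_rfl⟩
  rcases h0.eq_or_lt with rfl | hpos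
  · have := L.isStraight_const (c t) x t 0 le_rfl (by linarith) (by linarith)
      fun _ _ => by simpa using hl
    simpa using this
  set g := L.σ (c (t - h)) (c (t + h)) with hg
  set k : ℝ → X := fun s => c (t - h + 2 * h * s) with hk
  have hmaps : ∀ s ∈ Icc (0 : ℝ) 1, t - h + 2 * h * s ∈ Icc (t - h) (t + h) := fun s hs =>
    ⟨by nlinarith [hs.1], by nlinarith [hs.2]⟩
  have hkball : ∀ s ∈ Icc (0 : ℝ) 1, k s ∈ ball x (L.r x) := fun s hs => hu _ (hmaps s hs)
  have hgball : ∀ s ∈ Icc (0 : ℝ) 1, g s ∈ ball x (L.r x) := L.mem_ball x _ _ hl hr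
  have hkc : ContinuousOn k (Icc 0 1) := hc.comp (by fun_prop) fun s hs =>
    ⟨h1.trans (hmaps s hs).1, (hmaps s hs).2.trans h2⟩
  have hgc : ContinuousOn g (Icc 0 1) := L.continuousOn_σ hl hr
  have := le_chord_of_midpoint_le (f := fun s => dist (k s) (g s))
    (continuous_dist.comp_continuousOn (hkc.prodMk hgc)) ?_ (t := 1 / 2) (by norm_num)
  · have k0 : k 0 = c (t - h) := by simp [hk]
    have k1 : k 1 = c (t + h) := by simp only [hk]; ring_nf
    have km : k (1 / 2) = c t := by simp only [hk]; ring_nf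
    rw [k0, k1, km, hg, L.source x _ _ hl hr, L.target x _ _ hl hr, dist_self, dist_self] at this
    exact dist_le_zero.mp (by linarith)
  · intro s hs
    have hs' : t - h + 2 * h * s ∈ Ioo (0 : ℝ) 1 := ⟨by nlinarith [hs.1], by nlinarith [hs.2]⟩
    obtain ⟨δ, hδ, hmid⟩ := hloc _ hs'
    obtain ⟨η, hη, hη'⟩ := exists_between
      (lt_min (lt_min hs.1 (sub_pos.mpr hs.2)) (show 0 < δ / (2 * h) by positivity))
    obtain ⟨⟨hη1, hη2⟩, hη3⟩ := (lt_min_iff.mp hη').imp_left lt_min_iff.mp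
    rw [lt_div_iff₀ (by positivity)] at hη3
    have ha : s - η ∈ Icc (0 : ℝ) 1 := ⟨by linarith, by linarith [hs.2]⟩
    have hb : s + η ∈ Icc (0 : ℝ) 1 := ⟨by linarith [hs.1], by linarith⟩
    refine ⟨η, hη, ha.1, hb.2, ?_⟩
    have hks : k s = L.σ (k (s - η)) (k (s + η)) (1 / 2) := by
      have := hmid (2 * h * η) (by positivity) (by linarith)
      simp only [hk]
      rw [this]
      congr 2 <;> ring
    have hgs : g s = L.σ (g (s - η)) (g (s + η)) (1 / 2) := by
      rw [hg, L.consistent x _ _ hl hr _ _ ha.1 (by linarith) hb.2 _ (by norm_num)]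
      congr 1
      ring
    rw [hks, hgs]
    exact hL.two_mul_dist_le (hkball _ ha) (hkball _ hb) (hgball _ ha) (hgball _ hb)

theorem IsConvex.dist_le_of_isStraight (hL : L.IsConvex) {c c' : ℝ → X}
    (hc : ContinuousOn c (Icc 0 1)) (hc' : ContinuousOn c' (Icc 0 1)) (hs : L.IsStraight c)
    (hs' : L.IsStraight c')
    (hx : ∀ t ∈ Ioo (0 : ℝ) 1, ∃ x, c t ∈ ball x (L.r x) ∧ c' t ∈ ball x (L.r x))
    {t : ℝ} (ht : t ∈ Icc (0 : ℝ) 1) :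
    dist (c t) (c' t) ≤ (1 - t) * dist (c 0) (c' 0) + t * dist (c 1) (c' 1) := by
  refine le_chord_of_midpoint_le (f := fun t => dist (c t) (c' t))
    (continuous_dist.comp_continuousOn (hc.prodMk hc')) ?_ ht
  intro t ht
  obtain ⟨x, h1, h2⟩ := hx t ht
  have hn : Icc (0 : ℝ) 1 ∈ 𝓝 t := Icc_mem_nhds ht.1 ht.2
  have e1 := (hc.continuousAt hn).eventually_mem (isOpen_ball.mem_nhds h1)
  have e2 := (hc'.continuousAt hn).eventually_mem (isOpen_ball.mem_nhds h2)
  obtain ⟨δ, hδ, hball⟩ := Metric.eventually_nhds_iff_ball.mp ((e1.and e2).and hn)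
  have hu : ∀ u ∈ Icc (t - δ / 2) (t + δ / 2), u ∈ ball t δ := fun u hu => by
    rw [Metric.mem_ball, Real.dist_eq, abs_lt]
    constructor <;> linarith [hu.1, hu.2]
  have hl := hball _ (hu (t - δ / 2) ⟨le_rfl, by linarith⟩)
  have hr := hball _ (hu (t + δ / 2) ⟨by linarith, le_rfl⟩)
  refine ⟨δ / 2, by positivity, hl.2.1, hr.2.2, ?_⟩
  rw [hs x t (δ / 2) (by positivity) hl.2.1 hr.2.2 fun u h => (hball u (hu u h)).1.1,
    hs' x t (δ / 2) (by positivity) hl.2.1 hr.2.2 fun u h => (hball u (hu u h)).1.2]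
  exact hL.two_mul_dist_le hl.1.1 hr.1.1 hl.1.2 hr.1.2

end Straight

end LocalGeodesicBicombing

namespace LocalGeodesicBicombing

section Chain

variable {X : Type*} [MetricSpace X] {L : LocalGeodesicBicombing X}

/-- A discrete straight chain from `a 0` to `a N` can be deformed, by repeatedly taking midpoints,
into a straight chain from `a 0` to a nearby point `q`. -/
theorem IsConvex.exists_chain [CompleteSpace X] (hL : L.IsConvex) {N : ℕ} (hN : 0 < N)
    {a : ℕ → X} {η : ℝ}
    (hη : 0 ≤ η) (hmid : ∀ i, i + 1 < N → a (i + 1) = L.σ (a i) (a (i + 2)) (1 / 2))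
    (hball : ∀ i, i + 1 < N → ∃ x, closedBall (a i) η ⊆ ball x (L.r x) ∧
      closedBall (a (i + 2)) η ⊆ ball x (L.r x)) {q : X} (hq : dist q (a N) ≤ η) :
    ∃ y : ℕ → X, y 0 = a 0 ∧ (∀ i, N ≤ i → y i = q) ∧ (∀ i ≤ N, dist (y i) (a i) ≤ η) ∧
      ∀ i, i + 1 < N → y (i + 1) = L.σ (y i) (y (i + 2)) (1 / 2) := by
  let T : (ℕ → X) → ℕ → X := fun y i =>
    if 0 < i ∧ i < N then L.σ (y (i - 1)) (y (i + 1)) (1 / 2) else y i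
  let Y : ℕ → ℕ → X := fun k => k.rec (fun i => if i < N then a i else q) fun _ => T
  have hY : ∀ k i, i + 1 < N → Y (k + 1) (i + 1) = L.σ (Y k i) (Y k (i + 2)) (1 / 2) := by
    intro k i hi
    change T (Y k) (i + 1) = _
    simp [T, hi]
  have hY0 : ∀ k, Y k 0 = a 0 := fun k => by
    induction k with
    | zero => simp [Y, hN]
    | succ k ih => exact (show T (Y k) 0 = Y k 0 by simp [T]).trans ih
  have hYN : ∀ k i, N ≤ i → Y k i = q := fun k i hi => by
    induction k with
    | zero => simp [Y, hi]
    | succ k ih => exact (show T (Y k) i = Y k i by simp [T, hi]).trans ih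
  have hinit : ∀ i < N, Y 0 i = a i := fun i hi => by simp [Y, hi]
  clear_value Y
  have hcases : ∀ i, i = 0 ∨ N ≤ i ∨ ∃ j, j + 1 < N ∧ i = j + 1 := fun i => by
    rcases i with _ | j
    · exact Or.inl rfl
    · by_cases h : j + 1 < N
      · exact Or.inr (Or.inr ⟨j, h, rfl⟩)
      · exact Or.inr (Or.inl (not_lt.mp h))
  have hclose : ∀ k, ∀ i ≤ N, dist (Y k i) (a i) ≤ η := fun k => by
    induction k with
    | zero =>
      intro i hi
      rcases hi.eq_or_lt with rfl | hi
      · rwa [hYN _ _ le_rfl]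
      · rwa [hinit i hi, dist_self]
    | succ k ih =>
      intro i hi
      rcases hcases i with rfl | h | ⟨j, hj, rfl⟩
      · simpa [hY0] using hη
      · rwa [hYN _ _ h, le_antisymm hi h]
      · obtain ⟨x, h1, h2⟩ := hball j hj
        have i1 := ih j (by omega)
        have i2 := ih (j + 2) (by omega)
        have := hL.two_mul_dist_le (h1 i1) (h2 i2) (h1 (mem_closedBall_self hη))
          (h2 (mem_closedBall_self hη))
        rw [hY k j hj, hmid j hj]
        linarith
  have hN1 : (1 : ℝ) ≤ N := by exact_mod_cast hN
  set lam : ℝ := 1 - 1 / (2 * N ^ 2) with hlam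
  have hlam1 : lam < 1 := by
    have : (0 : ℝ) < 1 / (2 * N ^ 2) := by positivity
    linarith
  have hlam0 : 0 ≤ lam := by
    rw [hlam, sub_nonneg, div_le_one (by positivity)]
    nlinarith
  have hstep : ∀ k, ∀ i ≤ N, dist (Y (k + 1) i) (Y k i) ≤
      2 * η * lam ^ k * (2 * N ^ 2 - i ^ 2) := fun k => by
    have hw : ∀ i ≤ N, (0 : ℝ) ≤ 2 * N ^ 2 - i ^ 2 - 1 := fun i hi => by
      have : (i : ℝ) ≤ N := by exact_mod_cast hi
      nlinarith [Nat.cast_nonneg (α := ℝ) i]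
    induction k with
    | zero =>
      intro i hi
      have h1 := dist_triangle_right (Y 1 i) (Y 0 i) (a i)
      have h2 := hclose 0 i hi
      have h3 := hclose 1 i hi
      rw [pow_zero, mul_one, zero_add]
      nlinarith [hw i hi]
    | succ k ih =>
      intro i hi
      have hp := pow_nonneg hlam0
      rcases hcases i with rfl | h | ⟨j, hj, rfl⟩
      · rw [hY0, hY0, dist_self]
        have := hw 0 hi
        have := hp (k + 1)
        exact mul_nonneg (by positivity) (by linarith)
      · rw [hYN _ _ h, hYN _ _ h, dist_self]
        have := hw i hi
        have := hp (k + 1)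
        exact mul_nonneg (by positivity) (by linarith)
      · obtain ⟨x, h1, h2⟩ := hball j hj
        have := hL.two_mul_dist_le (h1 (hclose (k + 1) j (by omega)))
          (h2 (hclose (k + 1) (j + 2) (by omega))) (h1 (hclose k j (by omega)))
          (h2 (hclose k (j + 2) (by omega)))
        have i1 := ih j (by omega)
        have i2 := ih (j + 2) (by omega)
        rw [hY _ j hj, hY _ j hj]
        have key : (2 * N ^ 2 - ((j + 1 : ℕ) : ℝ) ^ 2) - 1 ≤
            lam * (2 * N ^ 2 - ((j + 1 : ℕ) : ℝ) ^ 2) := by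
          have : 1 / (2 * (N : ℝ) ^ 2) * (2 * N ^ 2 - ((j + 1 : ℕ) : ℝ) ^ 2) ≤ 1 := by
            rw [one_div_mul_eq_div, div_le_one (by positivity)]
            nlinarith [sq_nonneg ((j + 1 : ℕ) : ℝ)]
          rw [hlam]
          linarith
        have hc : 0 ≤ 2 * η * lam ^ k := by
          have := hp k
          positivity
        have key' := mul_le_mul_of_nonneg_left key hc
        push_cast at i1 i2 key' ⊢
        rw [pow_succ]
        nlinarith
  have hlim : ∀ i, ∃ z, Filter.Tendsto (fun k => Y k i) Filter.atTop (𝓝 z) := fun i => by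
    refine cauchySeq_tendsto_of_complete
      (cauchySeq_of_le_geometric lam (2 * η * (2 * N ^ 2)) hlam1 fun k => ?_)
    have hp := pow_nonneg hlam0 k
    by_cases hi : i ≤ N
    · rw [dist_comm]
      refine (hstep k i hi).trans ?_
      have : 0 ≤ 2 * η * lam ^ k := by positivity
      nlinarith [sq_nonneg (i : ℝ)]
    · rw [hYN _ _ (not_le.mp hi).le, hYN _ _ (not_le.mp hi).le, dist_self]
      positivity
  choose y hy using hlim
  have hyclose : ∀ i ≤ N, dist (y i) (a i) ≤ η := fun i hi =>
    le_of_tendsto' ((hy i).dist tendsto_const_nhds) fun k => hclose k i hi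
  refine ⟨y, ?_, ?_, hyclose, fun i hi => ?_⟩
  · exact tendsto_nhds_unique (hy 0) (by simp [hY0])
  · exact fun i hi => tendsto_nhds_unique (hy i) (by simp [hYN _ i hi])
  · obtain ⟨x, h1, h2⟩ := hball i hi
    refine tendsto_nhds_unique ((hy (i + 1)).comp (Filter.tendsto_add_atTop_nat 1)) ?_
    refine (hL.tendsto_midpoint (h1 (hyclose i (by omega))) (h2 (hyclose (i + 2) (by omega)))
      (hy i) (hy (i + 2))).congr fun k => ?_
    exact (hY k i hi).symm

end Chain

end LocalGeodesicBicombing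

namespace LocalGeodesicBicombing

section Polygon

variable {X : Type*} [MetricSpace X] {L : LocalGeodesicBicombing X} {y : ℕ → X}

/-- The concatenation of the segments `σ (y i) (y (i + 1))`, parametrized by `[0, ∞)`. -/
noncomputable def polygon (L : LocalGeodesicBicombing X) (y : ℕ → X) (t : ℝ) : X :=
  L.σ (y ⌊t⌋₊) (y (⌊t⌋₊ + 1)) (t - ⌊t⌋₊)

theorem polygon_eq (hdom : ∀ i, L.InDom (y i) (y (i + 1))) {i : ℕ} {t : ℝ}
    (ht : t ∈ Icc (i : ℝ) (i + 1)) : L.polygon y t = L.σ (y i) (y (i + 1)) (t - i) := by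
  rcases ht.2.eq_or_lt with rfl | h
  · obtain ⟨x, h1, h2⟩ := hdom i
    obtain ⟨x', h1', h2'⟩ := hdom (i + 1)
    have : ⌊(i : ℝ) + 1⌋₊ = i + 1 := by exact_mod_cast Nat.floor_natCast (R := ℝ) (i + 1)
    simp only [polygon, this]
    push_cast
    rw [sub_self, add_sub_cancel_left, L.target x _ _ h1 h2, L.source x' _ _ h1' h2']
  · have : ⌊t⌋₊ = i := (Nat.floor_eq_iff (i.cast_nonneg.trans ht.1)).mpr ⟨ht.1, h⟩
    simp only [polygon, this]

theorem polygon_natCast (hdom : ∀ i, L.InDom (y i) (y (i + 1))) (i : ℕ) :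
    L.polygon y i = y i := by
  obtain ⟨x, h1, h2⟩ := hdom i
  rw [polygon_eq hdom ⟨le_rfl, by linarith⟩, sub_self, L.source x _ _ h1 h2]

theorem continuousOn_polygon (hdom : ∀ i, L.InDom (y i) (y (i + 1))) (n : ℕ) :
    ContinuousOn (L.polygon y) (Icc 0 n) := by
  induction n with
  | zero => simp
  | succ n ih =>
    have hn : (0 : ℝ) ≤ n := n.cast_nonneg
    rw [Nat.cast_succ, ← Icc_union_Icc_eq_Icc hn (by linarith)]
    refine ih.union_of_isClosed ?_ isClosed_Icc isClosed_Icc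
    obtain ⟨x, h1, h2⟩ := hdom n
    refine ((L.continuousOn_σ h1 h2).comp (f := fun t : ℝ => t - n) (by fun_prop)
      fun t ht => ⟨by linarith [ht.1], by linarith [ht.2]⟩).congr fun t ht => polygon_eq hdom ht

theorem polygon_eq_midpoint (hdom : ∀ i, L.InDom (y i) (y (i + 1))) {N : ℕ}
    (hdom' : ∀ i, i + 1 < N → L.InDom (y i) (y (i + 2)))
    (hmid : ∀ i, i + 1 < N → y (i + 1) = L.σ (y i) (y (i + 2)) (1 / 2)) {t : ℝ}
    (ht : t ∈ Ioo (0 : ℝ) N) : ∃ δ > 0, ∀ h, 0 < h → h < δ →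
      L.polygon y t = L.σ (L.polygon y (t - h)) (L.polygon y (t + h)) (1 / 2) := by
  have hi := Nat.floor_le ht.1.le
  have hi' := Nat.lt_floor_add_one t
  have hiN := (Nat.floor_lt ht.1.le).mpr ht.2
  generalize ⌊t⌋₊ = i at hi hi' hiN
  rcases hi.eq_or_lt with rfl | hlt
  · obtain ⟨j, rfl⟩ := Nat.exists_eq_succ_of_ne_zero (by exact_mod_cast ht.1.ne' : i ≠ 0)
    simp only [Nat.succ_eq_add_one] at *
    obtain ⟨x, h1, h2⟩ := hdom' j hiN
    refine ⟨1, one_pos, fun h h0 hh => ?_⟩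
    have e1 : L.polygon y ((j + 1 : ℕ) - h) = L.σ (y j) (y (j + 2)) ((1 - h) / 2) := by
      rw [polygon_eq (i := j) hdom ⟨by push_cast; linarith, by push_cast; linarith⟩]
      have := L.consistent x _ _ h1 h2 0 (1 / 2) le_rfl (by norm_num) (by norm_num) (1 - h)
        ⟨by linarith, by linarith⟩
      rw [L.source x _ _ h1 h2, ← hmid j hiN] at this
      convert this using 2 <;> push_cast <;> ring
    have e2 : L.polygon y ((j + 1 : ℕ) + h) = L.σ (y j) (y (j + 2)) ((1 + h) / 2) := by
      rw [polygon_eq (i := j + 1) hdom ⟨by linarith, by linarith⟩]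
      have := L.consistent x _ _ h1 h2 (1 / 2) 1 (by norm_num) (by norm_num) le_rfl h
        ⟨by linarith, by linarith⟩
      rw [L.target x _ _ h1 h2, ← hmid j hiN] at this
      convert this using 2 <;> ring
    rw [e1, e2, polygon_natCast hdom, L.consistent x _ _ h1 h2 _ _ (by linarith) (by linarith)
      (by linarith) _ (by norm_num), hmid j hiN]
    congr 1
    ring
  · obtain ⟨x, h1, h2⟩ := hdom i
    refine ⟨min (t - i) (i + 1 - t), lt_min (by linarith) (by linarith), fun h h0 hh => ?_⟩
    obtain ⟨ha, hb⟩ := lt_min_iff.mp hh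
    rw [polygon_eq hdom ⟨hi, hi'.le⟩,
      polygon_eq (i := i) (t := t - h) hdom ⟨by linarith, by linarith⟩,
      polygon_eq (i := i) (t := t + h) hdom ⟨by linarith, by linarith⟩,
      L.consistent x _ _ h1 h2 _ _ (by linarith) (by linarith) (by linarith) _ (by norm_num)]
    congr 1
    ring

end Polygon

end LocalGeodesicBicombing

namespace LocalGeodesicBicombing

section Perturbation

variable {X : Type*} [MetricSpace X] {L : LocalGeodesicBicombing X}

/-- The endpoint of a straight curve can be moved freely in a neighborhood: the new endpoint is
the endpoint of a straight curve close to the original one. -/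
theorem IsConvex.exists_isStraight_near [CompleteSpace X] (hL : L.IsConvex) {c : ℝ → X}
    (hc : ContinuousOn c (Icc 0 1)) (hs : L.IsStraight c) {ε : ℝ} (hε : 0 < ε)
    (hball : ∀ t ∈ Icc (0 : ℝ) 1, ∃ x, ball (c t) ε ⊆ ball x (L.r x)) {q : X}
    (hq : dist q (c 1) < ε / 8) :
    ∃ c' : ℝ → X, ContinuousOn c' (Icc 0 1) ∧ L.IsStraight c' ∧ c' 0 = c 0 ∧ c' 1 = q ∧
      ∀ t ∈ Icc (0 : ℝ) 1, dist (c' t) (c t) ≤ dist q (c 1) := by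
  obtain ⟨δ, hδ, huc⟩ := Metric.uniformContinuousOn_iff.mp
    (isCompact_Icc.uniformContinuousOn_of_continuous hc) (ε / 8) (by positivity)
  obtain ⟨n, hn⟩ := exists_nat_gt (2 / δ)
  have hN : 0 < n + 1 := n.succ_pos
  have hNδ : 2 / δ < ((n + 1 : ℕ) : ℝ) := by push_cast; linarith
  generalize n + 1 = N at hN hNδ
  clear hn n
  have hN' : (0 : ℝ) < N := by exact_mod_cast hN
  have hNδ' : 2 / (N : ℝ) < δ := by
    rw [div_lt_iff₀ hδ] at hNδ
    rw [div_lt_iff₀ hN']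
    linarith
  have huc' : ∀ s ∈ Icc (0 : ℝ) N, ∀ t ∈ Icc (0 : ℝ) N, |s - t| ≤ 2 →
      dist (c (s / N)) (c (t / N)) < ε / 8 := by
    intro s hs t ht hst
    refine huc _ ⟨div_nonneg hs.1 hN'.le, (div_le_one hN').mpr hs.2⟩ _
      ⟨div_nonneg ht.1 hN'.le, (div_le_one hN').mpr ht.2⟩ ?_
    rw [Real.dist_eq, ← sub_div, abs_div, abs_of_pos hN']
    exact (div_le_div_of_nonneg_right hst hN'.le).trans_lt hNδ'
  have hballN : ∀ t ∈ Icc (0 : ℝ) N, ∃ x, ball (c (t / N)) ε ⊆ ball x (L.r x) := fun t ht =>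
    hball _ ⟨div_nonneg ht.1 hN'.le, (div_le_one hN').mpr ht.2⟩
  set η := dist q (c 1) with hη
  have hη0 : 0 ≤ η := dist_nonneg
  have hmem : ∀ i : ℕ, i ≤ N → (i : ℝ) ∈ Icc (0 : ℝ) N := fun i hi =>
    ⟨i.cast_nonneg, by exact_mod_cast hi⟩
  have hmid : ∀ i : ℕ, i + 1 < N →
      c ((i + 1 : ℕ) / N) = L.σ (c (i / N)) (c ((i + 2 : ℕ) / N)) (1 / 2) := by
    intro i hi
    obtain ⟨x, hx⟩ := hballN _ (hmem (i + 1) hi.le)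
    have hi2 := (hmem (i + 2) hi).2
    have e1 : ((i + 1 : ℕ) : ℝ) / N - 1 / N = i / N := by push_cast; ring
    have e2 : ((i + 1 : ℕ) : ℝ) / N + 1 / N = (i + 2 : ℕ) / N := by push_cast; ring
    have := hs x ((i + 1 : ℕ) / N) (1 / N) (by positivity) (by rw [e1]; positivity)
      (by rw [e2, div_le_one hN']; exact hi2) fun u hu => hx ?_
    · rwa [e1, e2] at this
    · rw [e1, e2, mem_Icc, div_le_iff₀ hN', le_div_iff₀ hN'] at hu
      push_cast at hi2 hu
      have := huc' (u * N) ⟨i.cast_nonneg.trans hu.1, by linarith⟩ _ (hmem (i + 1) hi.le)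
        (by push_cast; rw [abs_le]; constructor <;> linarith)
      rw [mul_div_cancel_right₀ _ hN'.ne'] at this
      rw [Metric.mem_ball]
      linarith
  have hcb : ∀ i : ℕ, i + 1 < N → ∃ x, closedBall (c (i / N)) η ⊆ ball x (L.r x) ∧
      closedBall (c ((i + 2 : ℕ) / N)) η ⊆ ball x (L.r x) := by
    intro i hi
    obtain ⟨x, hx⟩ := hballN _ (hmem (i + 1) hi.le)
    refine ⟨x, (closedBall_subset_ball' ?_).trans hx, (closedBall_subset_ball' ?_).trans hx⟩
    · have := huc' _ (hmem i (by omega)) _ (hmem (i + 1) hi.le) (by push_cast; norm_num)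
      linarith
    · have := huc' _ (hmem (i + 2) hi) _ (hmem (i + 1) hi.le) (by push_cast; norm_num)
      linarith
  obtain ⟨y, y0, yN, yclose, ymid⟩ := hL.exists_chain hN (a := fun i => c (i / N)) hη0 hmid hcb
    (q := q) (by simp [hη, hN'.ne'])
  have yball : ∀ i ≤ N, ∀ t ∈ Icc (0 : ℝ) N, |(i : ℝ) - t| ≤ 2 →
      dist (y i) (c (t / N)) < ε / 4 := fun i hi t ht hit => by
    have h1 := dist_triangle (y i) (c (i / N)) (c (t / N))
    have h2 := huc' _ (hmem i hi) _ ht hit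
    have h3 := yclose i hi
    linarith
  have ydom : ∀ i j, i ≤ j → j ≤ i + 2 → j ≤ N → L.InDom (y i) (y j) := fun i j hij hj hjN => by
    obtain ⟨x, hx⟩ := hballN _ (hmem i (by omega))
    have hj' : (j : ℝ) ≤ i + 2 := by exact_mod_cast hj
    have hij' : (i : ℝ) ≤ j := by exact_mod_cast hij
    have h1 := yball i (by omega) _ (hmem i (by omega)) (by simp)
    have h2 := yball j hjN _ (hmem i (by omega)) (by rw [abs_le]; constructor <;> linarith)
    refine ⟨x, hx ?_, hx ?_⟩ <;> rw [Metric.mem_ball] <;> linarith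
  have hdom : ∀ i, L.InDom (y i) (y (i + 1)) := fun i => by
    by_cases hi : i + 1 ≤ N
    · exact ydom i (i + 1) (by omega) (by omega) hi
    · rw [yN i (by omega), yN (i + 1) (by omega)]
      exact ⟨q, mem_ball_self (L.r_pos q), mem_ball_self (L.r_pos q)⟩
  have hc' : ContinuousOn (fun t : ℝ => L.polygon y (N * t)) (Icc 0 1) :=
    (continuousOn_polygon hdom N).comp (by fun_prop) fun t ht =>
      ⟨mul_nonneg hN'.le ht.1, mul_le_of_le_one_right hN'.le ht.2⟩
  have hs' : L.IsStraight fun t : ℝ => L.polygon y (N * t) :=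
    hL.isStraight_of_locally hc' fun t ht => by
      obtain ⟨δ', hδ', h⟩ := polygon_eq_midpoint hdom
        (fun i hi => ydom i (i + 2) (by omega) le_rfl hi) ymid (t := N * t)
        ⟨mul_pos hN' ht.1, mul_lt_of_lt_one_right hN' ht.2⟩
      refine ⟨δ' / N, by positivity, fun h' h0 h1 => ?_⟩
      rw [lt_div_iff₀ hN'] at h1
      rw [mul_sub, mul_add]
      exact h (N * h') (by positivity) (by linarith)
  have hc0 : L.polygon y (N * 0) = c 0 := by
    simpa [y0] using polygon_natCast hdom 0
  have hc1 : L.polygon y (N * 1) = q := by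
    rw [mul_one, polygon_natCast hdom, yN N le_rfl]
  refine ⟨_, hc', hs', hc0, hc1, fun t ht => ?_⟩
  have := hL.dist_le_of_isStraight hc' hc hs' hs (fun t ht => ?_) ht
  · simp only [mul_zero (N : ℝ)] at this hc0
    simp only [hc0, hc1, dist_self, mul_zero, zero_add] at this
    exact this.trans (mul_le_of_le_one_left hη0 ht.2)
  · obtain ⟨x, hx⟩ := hball t ⟨ht.1.le, ht.2.le⟩
    refine ⟨x, hx ?_, hx (mem_ball_self hε)⟩
    have htN : (N : ℝ) * t ∈ Ioo (0 : ℝ) N :=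
      ⟨mul_pos hN' ht.1, mul_lt_of_lt_one_right hN' ht.2⟩
    have hi := Nat.floor_le htN.1.le
    have hi' := Nat.lt_floor_add_one ((N : ℝ) * t)
    have hiN := (Nat.floor_lt htN.1.le).mpr htN.2
    generalize ⌊(N : ℝ) * t⌋₊ = i at hi hi' hiN
    obtain ⟨z, h1, h2⟩ := hdom i
    have h3 := L.geodesic z _ _ h1 h2 (N * t - i) ⟨by linarith, by linarith⟩ 0 (by norm_num)
    rw [L.source z _ _ h1 h2, sub_zero, abs_of_nonneg (by linarith)] at h3
    have h4 := yball i hiN.le _ ⟨htN.1.le, htN.2.le⟩ (by rw [abs_le]; constructor <;> linarith)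
    have h5 := yball (i + 1) hiN _ ⟨htN.1.le, htN.2.le⟩
      (by push_cast; rw [abs_le]; constructor <;> linarith)
    rw [mul_div_cancel_left₀ _ hN'.ne'] at h4 h5
    have h6 := dist_triangle_right (y i) (y (i + 1)) (c t)
    have h7 := mul_le_of_le_one_left (dist_nonneg (x := y i) (y := y (i + 1)))
      (show (N : ℝ) * t - i ≤ 1 by linarith)
    have h8 := dist_triangle (L.σ (y i) (y (i + 1)) (N * t - i)) (y i) (c t)
    rw [Metric.mem_ball, polygon_eq hdom ⟨hi, hi'.le⟩]
    linarith

end Perturbation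

end LocalGeodesicBicombing

namespace LocalGeodesicBicombing

section StraightCurves

variable {X : Type*} [MetricSpace X] {L : LocalGeodesicBicombing X}

/-- The space of straight curves issuing from `x₀`, with the metric of uniform convergence. -/
def straightCurves (L : LocalGeodesicBicombing X) (x₀ : X) : Set C(I, X) :=
  {c | c 0 = x₀ ∧ L.IsStraight (IccExtend zero_le_one c)}

theorem IsConvex.isClosed_straightCurves (hL : L.IsConvex) (x₀ : X) :
    IsClosed (L.straightCurves x₀) := by
  refine IsSeqClosed.isClosed fun c c' hc hcc' => ⟨?_, ?_⟩
  · exact tendsto_nhds_unique ((continuous_eval_const 0).tendsto c' |>.comp hcc')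
      (tendsto_const_nhds.congr fun n => (hc n).1.symm)
  intro x t h h0 h1 h2 hu
  have hK : IsCompact (projIcc (0 : ℝ) 1 zero_le_one '' Icc (t - h) (t + h)) :=
    isCompact_Icc.image continuous_projIcc
  have hmaps := hcc'.eventually (ContinuousMap.eventually_mapsTo hK
    (isOpen_ball (x := x) (ε := L.r x)) (by rintro _ ⟨u, hu', rfl⟩; exact hu u hu'))
  have hev : ∀ u, Filter.Tendsto (fun n => IccExtend zero_le_one (c n) u) Filter.atTop
      (𝓝 (IccExtend zero_le_one c' u)) := fun u =>
    (continuous_eval_const (projIcc 0 1 zero_le_one u)).tendsto c' |>.comp hcc'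
  refine tendsto_nhds_unique (hev t) ((hL.tendsto_midpoint (hu _ ⟨le_rfl, by linarith⟩)
    (hu _ ⟨by linarith, le_rfl⟩) (hev _) (hev _)).congr' ?_)
  filter_upwards [hmaps] with n hn
  exact ((hc n).2 x t h h0 h1 h2 fun u hu' => hn ⟨u, hu', rfl⟩).symm

/-- The endpoint map on the space of straight curves is a local isometry. -/
theorem IsConvex.isLocalIsometry_endpoint [CompleteSpace X] (hL : L.IsConvex) (x₀ : X) :
    IsLocalIsometry fun c : L.straightCurves x₀ => (c : C(I, X)) 1 := by
  intro c
  obtain ⟨ε, hε, hball⟩ := lebesgue_number_lemma_of_metric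
    (isCompact_range (c : C(I, X)).continuous) (c := fun x => ball x (L.r x))
    (fun x => isOpen_ball) fun y _ => mem_iUnion.mpr ⟨y, mem_ball_self (L.r_pos y)⟩
  replace hball : ∀ t : I, ∃ x, ball ((c : C(I, X)) t) ε ⊆ ball x (L.r x) := fun t =>
    hball _ (mem_range_self t)
  have hext : ∀ c : L.straightCurves x₀,
      ContinuousOn (IccExtend zero_le_one (c : C(I, X))) (Icc (0 : ℝ) 1) := fun c =>
    (c : C(I, X)).continuous.Icc_extend'.continuousOn
  refine ⟨ε / 8, by positivity, fun c' hc' c'' hc'' => le_antisymm ?_ ?_, fun y hy => ?_⟩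
  · exact ContinuousMap.dist_apply_le_dist 1
  · refine (ContinuousMap.dist_le dist_nonneg).mpr fun t => ?_
    have := hL.dist_le_of_isStraight (hext c') (hext c'') c'.2.2 c''.2.2 (fun t ht => ?_) t.2
    · simp only [IccExtend_val, IccExtend_left, IccExtend_right] at this
      have h0 : (c' : C(I, X)) 0 = (c'' : C(I, X)) 0 := c'.2.1.trans c''.2.1.symm
      have h0' : dist ((c' : C(I, X)) ⟨0, left_mem_Icc.mpr zero_le_one⟩)
        ((c'' : C(I, X)) ⟨0, left_mem_Icc.mpr zero_le_one⟩) = 0 := dist_eq_zero.mpr h0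
      rw [h0', mul_zero, zero_add] at this
      exact this.trans (mul_le_of_le_one_left dist_nonneg t.2.2)
    · have ht' : t ∈ Icc (0 : ℝ) 1 := ⟨ht.1.le, ht.2.le⟩
      obtain ⟨x, hx⟩ := hball ⟨t, ht'⟩
      rw [IccExtend_of_mem _ _ ht', IccExtend_of_mem _ _ ht']
      have h1 : dist (c' : C(I, X)) c < ε / 8 := hc'
      have h2 : dist (c'' : C(I, X)) c < ε / 8 := hc''
      refine ⟨x, hx ?_, hx ?_⟩
      · exact (ContinuousMap.dist_apply_le_dist _).trans_lt (by linarith)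
      · exact (ContinuousMap.dist_apply_le_dist _).trans_lt (by linarith)
  · have hc1 : IccExtend zero_le_one (c : C(I, X)) (1 : ℝ) = (c : C(I, X)) 1 :=
      IccExtend_right _ _
    obtain ⟨c', hc', hs', h0, h1, hd⟩ := hL.exists_isStraight_near (hext c) c.2.2 hε
      (fun t ht => by rw [IccExtend_of_mem _ _ ht]; exact hball _) (q := y) (by rwa [hc1])
    let k : C(I, X) := ⟨(Icc 0 1).domRestrict c', continuousOn_iff_continuous_domRestrict.mp hc'⟩
    refine ⟨⟨k, ?_, hs'.congr fun t ht => (IccExtend_of_mem zero_le_one k ht).symm⟩, ?_, h1⟩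
    · exact h0.trans ((IccExtend_left _ _).trans c.2.1)
    · refine lt_of_le_of_lt ((ContinuousMap.dist_le dist_nonneg).mpr fun t => ?_)
        (show dist y ((c : C(I, X)) 1) < ε / 8 from hy)
      have := hd t t.2
      rwa [IccExtend_val, hc1] at this

end StraightCurves

section Covering

variable {X : Type*} [MetricSpace X] {L : LocalGeodesicBicombing X}

theorem isPathConnected_ball (L : LocalGeodesicBicombing X) {x : X} {ρ : ℝ} (hρ : 0 < ρ)
    (hρ' : ρ ≤ L.r x) : IsPathConnected (ball x ρ) := by
  refine ⟨x, mem_ball_self hρ, fun {y} hy => ?_⟩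
  have hx := mem_ball_self (x := x) (L.r_pos x)
  have hy' := ball_subset_ball hρ' hy
  refine JoinedIn.ofLine (L.continuousOn_σ hx hy') (L.source x _ _ hx hy')
    (L.target x _ _ hx hy') ?_
  rintro _ ⟨t, ht, rfl⟩
  have := L.geodesic x _ _ hx hy' t ht 0 (by norm_num)
  rw [L.source x _ _ hx hy', sub_zero, abs_of_nonneg ht.1, dist_comm x] at this
  rw [Metric.mem_ball, this]
  exact (mul_le_of_le_one_left dist_nonneg ht.2).trans_lt hy

theorem locallyPathConnectedSpace (L : LocalGeodesicBicombing X) : LocallyPathConnectedSpace X := by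
  refine LocallyPathConnectedSpace.of_bases (p := fun x ρ => 0 < ρ ∧ ρ ≤ L.r x)
    (s := fun x ρ => ball x ρ) (fun x => ?_) fun x ρ h => L.isPathConnected_ball h.1 h.2
  refine Metric.nhds_basis_ball.to_hasBasis (fun ρ hρ => ?_) fun ρ hρ => ⟨ρ, hρ.1, subset_rfl⟩
  exact ⟨min ρ (L.r x), ⟨lt_min hρ (L.r_pos x), min_le_right _ _⟩,
    ball_subset_ball (min_le_left _ _)⟩

theorem IsConvex.continuous_σ (hL : L.IsConvex) {x y : X} (hy : y ∈ ball x (L.r x)) :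
    Continuous fun a : I × ball x (L.r x) => L.σ y a.2 a.1 := by
  refine continuous_prod_of_continuous_lipschitzWith' _ 1 (fun t => ?_) fun z => ?_
  · refine LipschitzWith.of_dist_le_mul fun z z' => ?_
    have := hL.dist_le hy z.2 hy z'.2 t.2
    rw [dist_self, mul_zero, zero_add] at this
    rw [NNReal.coe_one, one_mul]
    exact this.trans (mul_le_of_le_one_left dist_nonneg t.2.2)
  · exact (L.continuousOn_σ hy z.2).comp_continuous continuous_subtype_val fun t => t.2

/-- A local isometry from a complete space onto a space with a convex local geodesic bicombing
is a covering map. -/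
theorem IsConvex.isCoveringMap (hL : L.IsConvex) {E : Type*} [MetricSpace E] [CompleteSpace E]
    {p : E → X} (hp : IsLocalIsometry p) : IsCoveringMap p := by
  intro x
  refine hp.isLocalHomeomorph.isEvenlyCovered_of_sections (T2Space.isSeparatedMap p) isOpen_ball
    (L.isPathConnected_ball (L.r_pos x) le_rfl).isConnected.isPreconnected
    (mem_ball_self (L.r_pos x)) fun e he => ?_
  have hgeod : ∀ (z : ball x (L.r x)) (t t' : I),
      dist (L.σ (p e) z t) (L.σ (p e) z t') ≤ dist (p e) z * |(t : ℝ) - t'| := fun z t t' => by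
    rw [mul_comm]
    exact (L.geodesic x _ _ he z.2 t t.2 t' t'.2).le
  obtain ⟨s, hs, hps, hds⟩ := hp.exists_lift_of_contraction ⟨_, hL.continuous_σ he⟩
    (fun z => dist_nonneg) hgeod (e := e) fun z => L.source x _ _ he z.2
  refine ⟨s, hs, fun z => (hps z).trans (L.target x _ _ he z.2), ?_⟩
  have := hds ⟨p e, he⟩
  rw [dist_self] at this
  exact (dist_le_zero.mp this).symm

end Covering

end LocalGeodesicBicombing

/-- A complete, simply-connected metric space with a convex local geodesic bicombing is
contractible. -/
theorem contractible_of_convex_local_bicombing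
    {X : Type*} [MetricSpace X] [CompleteSpace X] [SimplyConnectedSpace X]
    (L : LocalGeodesicBicombing X) (hL : L.IsConvex) :
    ContractibleSpace X := by
  obtain ⟨x₀⟩ : Nonempty X := inferInstance
  have : CompleteSpace (L.straightCurves x₀) :=
    (hL.isClosed_straightCurves x₀).completeSpace_coe
  have : LocallyPathConnectedSpace X := L.locallyPathConnectedSpace
  obtain ⟨s, ⟨-, hs⟩, -⟩ := (hL.isCoveringMap
    (hL.isLocalIsometry_endpoint x₀)).existsUnique_continuousMap_lifts (ContinuousMap.id X) x₀
    ⟨ContinuousMap.const I x₀, rfl, (L.isStraight_const x₀).congr fun _ _ => rfl⟩ rfl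
  rw [contractible_iff_id_nullhomotopic]
  refine ⟨x₀, ContinuousMap.Homotopic.symm ⟨
    { toFun := fun a => (s a.2 : C(I, X)) a.1
      continuous_toFun := ?_
      map_zero_left := fun y => (s y).2.1
      map_one_left := fun y => congrFun hs y }⟩⟩
  exact continuous_eval.comp
    ((continuous_subtype_val.comp (s.continuous.comp continuous_snd)).prodMk continuous_fst)
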